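/- Fix an integer r ≥ 2 and n ≥ 4. Then F(z_n) = x_1^{−c_n} · x_2^{−c_{n−1}} · Σ_{V ⊆ [1, c_{n−1}]} Σ_{h ∈ ℤ} C(c_n − |f(V)| − δ_V, h − δ_V) · x_1^{r·|V|} · x_2^{r·(c_n − |f(V)| − h)}, where for integers A, B the generalized binomial coefficient C(A,B) equals (Π_{i=0}^{B−1}(A−i))/B! if B > 0, equals 1 if B = 0, and equals 0 if B < 0. -/

import Mathlib

open scoped Classical

namespace CF

noncomputable section

/-- The sequence `c` : `c 1 = 0`, `c 2 = 1`, `c n = r * c (n-1) - c (n-2)`.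
(The value `c 0 = -1` is the unique value consistent with the recurrence.) -/
def c (r : ℕ) : ℕ → ℤ
  | 0 => -1
  | 1 => 0
  | n + 2 => (r : ℤ) * c r (n + 1) - c r n

/-- `c` as a natural number (valid for indices `≥ 1` when `r ≥ 2`). -/
def cN (r n : ℕ) : ℕ := (c r n).toNat

/-- Height (y-coordinate) of the vertex `w_k` of the maximal Dyck path `D_n`:
the maximal Dyck path from `(0,0)` to `(c_{n-1}-c_{n-2}, c_{n-2})` weakly below the
diagonal has `w_k = (k - ⌊k·c_{n-2}/c_{n-1}⌋, ⌊k·c_{n-2}/c_{n-1}⌋)`. -/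
def hgt (r n k : ℕ) : ℕ := k * cN r (n - 2) / cN r (n - 1)

/-- The edge `α_j` of `D_n` is vertical (a north step). -/
def isVert (r n j : ℕ) : Prop := hgt r n (j - 1) < hgt r n j

/-- Index in the vertex sequence `w_0, …, w_{c_{n-1}}` of the vertex `v_j`
(the upper endpoint of the `j`-th vertical edge); `vpos r n 0 = 0`. -/
def vpos (r n j : ℕ) : ℕ := (j * cN r (n - 1) + cN r (n - 2) - 1) / cN r (n - 2)

/-- x-coordinate of the vertex `v_j` of `D_n` (its y-coordinate is `j`). -/
def vx (r n j : ℕ) : ℤ := (vpos r n j : ℤ) - (j : ℤ)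

/-- The slope `s_{i,t}` between `v_i` and `v_t` is at most the slope `s` of the diagonal,
expressed by cross-multiplication. -/
def slopeLE (r n i t : ℕ) : Prop :=
  ((t : ℤ) - (i : ℤ)) * (c r (n - 1) - c r (n - 2)) ≤ (vx r n t - vx r n i) * c r (n - 2)

/-- `{t | i < t ≤ k, s_{i,t} > s}`. -/
def badSet (r n i k : ℕ) : Finset ℕ :=
  (Finset.Icc (i + 1) k).filter fun t => ¬ slopeLE r n i t

/-- `α(i,k)` is blue: `s_{i,t} ≤ s` for all `i < t ≤ k`. -/
def isBlue (r n i k : ℕ) : Prop := badSet r n i k = ∅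

/-- `t₀` is the minimum of `{t | i < t ≤ k, s_{i,t} > s}`. -/
def minBad (r n i k t₀ : ℕ) : Prop :=
  t₀ ∈ badSet r n i k ∧ ∀ t ∈ badSet r n i k, t₀ ≤ t

/-- `α(i,k)` is `(m,w)`-green: the minimum `t₀` of `{t | i < t ≤ k, s_{i,t} > s}` exists and
equals `i + c_m - w·c_{m-1}`, with `3 ≤ m ≤ n-2` and `1 ≤ w < r-1`. -/
def isGreenMW (r n i k m w : ℕ) : Prop :=
  3 ≤ m ∧ m + 2 ≤ n ∧ 1 ≤ w ∧ (w : ℤ) < (r : ℤ) - 1 ∧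
    ∃ t₀ : ℕ, minBad r n i k t₀ ∧ (t₀ : ℤ) = (i : ℤ) + (c r m - (w : ℤ) * c r (m - 1))

def isGreen (r n i k : ℕ) : Prop := ∃ m w, isGreenMW r n i k m w

/-- `α(i,k)` is red: neither blue nor green. -/
def isRed (r n i k : ℕ) : Prop := ¬ isBlue r n i k ∧ ¬ isGreen r n i k

/-- An element of `P(D_n)`: either a single edge `α_j` (`Sum.inl j`) or a subpath
`α(i,k)` (`Sum.inr (i,k)`). -/
abbrev Elt := ℕ ⊕ ℕ × ℕ

/-- The set of (indices of) edges of `D_n` constituting an element of `P(D_n)`: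
a single edge; for `α(i,k)`, the edges from `v_i` (or from its immediate predecessor,
in the red case) to `v_k`. -/
def edges (r n : ℕ) : Elt → Finset ℕ
  | Sum.inl j => {j}
  | Sum.inr (i, k) =>
      if isRed r n i k then Finset.Icc (vpos r n i) (vpos r n k)
      else Finset.Icc (vpos r n i + 1) (vpos r n k)

/-- Validity of an element of `P(D_n)`: `1 ≤ j ≤ c_{n-1}` for a single edge,
`0 ≤ i < k ≤ c_{n-2}` for a subpath `α(i,k)`. -/
def validElt (r n : ℕ) : Elt → Prop
  | Sum.inl j => 1 ≤ j ∧ (j : ℤ) ≤ c r (n - 1)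
  | Sum.inr (i, k) => i < k ∧ (k : ℤ) ≤ c r (n - 2)

/-- The common conditions on a collection `β = {β_1,…,β_t}` of elements of `P(D_n)`:
all elements are valid, distinct elements share no edge, and for any two subpaths
`α(i,k)`, `α(i',k')` one has `i ≠ k'` and `i' ≠ k`. -/
def validColl (r n : ℕ) (β : Finset Elt) : Prop :=
  (∀ p ∈ β, validElt r n p) ∧
  (∀ p ∈ β, ∀ q ∈ β, p ≠ q → Disjoint (edges r n p) (edges r n q)) ∧
  (∀ i k i' k' : ℕ, Sum.inr (i, k) ∈ β → Sum.inr (i', k') ∈ β → i ≠ k' ∧ i' ≠ k)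

/-- The `c_{m-1} - w·c_{m-2}` edges of `D_n` immediately preceding the vertex `v_i`. -/
def precEdges (r n i m w : ℕ) : Finset ℕ :=
  Finset.Icc (vpos r n i + 1 - (c r (m - 1) - (w : ℤ) * c r (m - 2)).toNat) (vpos r n i)

/-- The set `F(D_n)`. -/
def FD (r n : ℕ) : Set (Finset Elt) :=
  {β | validColl r n β ∧
    ∀ i k m w : ℕ, Sum.inr (i, k) ∈ β → isGreenMW r n i k m w →
      ∃ e ∈ precEdges r n i m w, ∃ p ∈ β, e ∈ edges r n p}

/-- The set `F̃(D_n)`. -/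
def Ftilde (r n : ℕ) : Set (Finset Elt) := {β | validColl r n β}

/-- The set `T^{≥u}(D_n)`. -/
def Tge (r n u : ℕ) : Set (Finset Elt) :=
  {β | validColl r n β ∧ β.Nonempty ∧
    ∃ i k m w : ℕ, u ≤ m ∧ Sum.inr (i, k) ∈ β ∧ isGreenMW r n i k m w ∧
      ∀ e ∈ precEdges r n i m w, ∀ p ∈ β, e ∉ edges r n p}

/-- `|β_j|_1` for a single element. -/
def wt1 : Elt → ℕ
  | Sum.inl _ => 0
  | Sum.inr (i, k) => k - i

/-- `|β|_1`. -/
def B1 (β : Finset Elt) : ℕ := ∑ p ∈ β, wt1 p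

/-- `|β|_2`: the total number of edges in the collection `β`. -/
def B2 (r n : ℕ) (β : Finset Elt) : ℕ := (β.biUnion (edges r n)).card

/-- The field `ℚ(x₁,x₂)`. -/
abbrev K := FractionRing (MvPolynomial (Fin 2) ℚ)

/-- The indeterminate `x₁`. -/
def x₁ : K := algebraMap (MvPolynomial (Fin 2) ℚ) K (MvPolynomial.X 0)

/-- The indeterminate `x₂`. -/
def x₂ : K := algebraMap (MvPolynomial (Fin 2) ℚ) K (MvPolynomial.X 1)

/-- `b_{n-1,k}`: `r` if the edge `α_k` of `D_n` is horizontal, `r-1` if vertical. -/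
def bseq (r n k : ℕ) : ℕ := if isVert r n k then r - 1 else r

/-- Prefix sums `S e = Σ_{k=1}^{e} b_{n-1,k}`. -/
def S (r n e : ℕ) : ℕ := ∑ k ∈ Finset.Icc 1 e, bseq r n k

/-- The interval `[a,b] ⊆ [1,c_n]` is (the edge set of) a blue or green subpath of `D_{n+1}`. -/
def isBGinterval (r n a b : ℕ) : Prop :=
  ∃ i k : ℕ, i < k ∧ (k : ℤ) ≤ c r (n - 1) ∧ ¬ isRed r (n + 1) i k ∧
    Finset.Icc a b = Finset.Icc (vpos r (n + 1) i + 1) (vpos r (n + 1) k)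

/-- Left endpoints of the maximal interval components of `V`. -/
def starts (V : Finset ℕ) : Finset ℕ := V.filter fun e => e - 1 ∉ V

/-- Right endpoint of the maximal interval component of `V` starting at `e`. -/
def compEnd (V : Finset ℕ) (e : ℕ) : ℕ := sSup {g : ℕ | Finset.Icc e g ⊆ V}

/-- `f_i(V)`: the image of the maximal interval component of `V` starting at `e`. -/
def fcomp (r n : ℕ) (V : Finset ℕ) (e : ℕ) : Finset ℕ :=
  if isBGinterval r n (S r n (e - 1) + 1) (S r n (compEnd V e)) then
    Finset.Icc (S r n (e - 1) + 1) (S r n (compEnd V e))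
  else
    insert (S r n (e - 1)) (Finset.Icc (S r n (e - 1) + 1) (S r n (compEnd V e)))

/-- The map `f` from subsets of `[1,c_{n-1}]` to subsets of `[1,c_n]`. -/
def fmap (r n : ℕ) (V : Finset ℕ) : Finset ℕ := (starts V).biUnion (fcomp r n V)

/-- The pull-back `f*` (of the map `f` one level down, from subsets of `[1,c_{n-2}]`
to subsets of `[1,c_{n-1}]`). -/
def fstar (r n : ℕ) (W : Finset ℕ) : Finset ℕ :=
  ((Finset.Icc 1 (cN r (n - 2))).powerset.filter fun U => fmap r (n - 1) U ⊆ W).biUnion id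

/-- `δ` of a maximal interval component `[e,g]`: `1` if the `w`-th edge of the corresponding
subpath of `D_n` is vertical for some `2 ≤ w ≤ r-1`, and `0` otherwise. -/
def deltaComp (r n e g : ℕ) : ℕ :=
  if ∃ w : ℕ, 2 ≤ w ∧ w ≤ r - 1 ∧ e + w - 1 ≤ g ∧ isVert r n (e + w - 1) then 1 else 0

/-- `δ_V`. -/
def deltaV (r n : ℕ) (V : Finset ℕ) : ℕ :=
  ∑ e ∈ starts V, deltaComp r n e (compEnd V e)

/-- Generalized binomial coefficient for integers `A`, `B`. -/
def gbinom (A B : ℤ) : ℚ :=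
  if B < 0 then 0
  else (∏ i ∈ Finset.range B.toNat, ((A : ℚ) - (i : ℚ))) / (B.toNat.factorial : ℚ)

/-- `z_n` for `n ≥ 4`, given by the sum over `F̃(D_n)`. -/
def zF (r n : ℕ) : K :=
  x₁ ^ (-(c r (n - 1))) * x₂ ^ (-(c r (n - 2))) *
    ∑ᶠ β ∈ Ftilde r n,
      x₁ ^ ((r : ℤ) * (B1 β : ℤ)) * x₂ ^ ((r : ℤ) * (c r (n - 1) - (B2 r n β : ℤ)))

/-- `z_n`, with `z_3 = x_3` (the value `x3` is the cluster variable `x_3`). -/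
def z (r : ℕ) (x3 : K) (n : ℕ) : K := if n = 3 then x3 else zF r n

end

noncomputable section

/-! ### Arithmetic of the sequence `c` -/

theorem c_rec (r n : ℕ) (hn : 2 ≤ n) : c r n = (r : ℤ) * c r (n - 1) - c r (n - 2) := by
  obtain ⟨m, rfl⟩ := Nat.exists_eq_add_of_le' hn
  rfl

theorem c_mono_aux (r : ℕ) (hr : 2 ≤ r) (n : ℕ) : c r n < c r (n + 1) ∧ 0 ≤ c r (n + 1) := by
  induction n with
  | zero => simp [c]
  | succ k ih =>
    have h : c r (k + 1 + 1) = (r : ℤ) * c r (k + 1) - c r k := rfl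
    have h2 : (2 : ℤ) ≤ r := by exact_mod_cast hr
    constructor <;> nlinarith [ih.1, ih.2]

theorem c_lt (r : ℕ) (hr : 2 ≤ r) (n : ℕ) : c r n < c r (n + 1) := (c_mono_aux r hr n).1

theorem c_nonneg (r : ℕ) (hr : 2 ≤ r) (n : ℕ) (hn : 1 ≤ n) : 0 ≤ c r n := by
  obtain ⟨m, rfl⟩ := Nat.exists_eq_add_of_le' hn
  exact (c_mono_aux r hr m).2

theorem cN_cast (r : ℕ) (hr : 2 ≤ r) (n : ℕ) (hn : 1 ≤ n) : (cN r n : ℤ) = c r n :=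
  Int.toNat_of_nonneg (c_nonneg r hr n hn)

theorem c_det (r j m : ℕ) :
    c r (m + 1) * c r (m + j) - c r m * c r (m + j + 1) = c r (j + 1) := by
  induction m with
  | zero => simp [c]
  | succ k ih =>
    have h1 : c r (k + 1 + 1) = (r : ℤ) * c r (k + 1) - c r k := rfl
    have h2 : c r (k + 1 + j + 1) = (r : ℤ) * c r (k + j + 1) - c r (k + j) := by
      rw [show k + 1 + j + 1 = k + j + 2 by ring]; rfl
    rw [h1, h2, ← ih, show k + 1 + j = k + j + 1 by ring]
    ring

/-- All numerical data about `D_n`. -/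
theorem dat (r n : ℕ) (hr : 2 ≤ r) (hn : 4 ≤ n) :
    ∃ d : ℕ, (d : ℤ) = c r (n - 3) ∧ d < cN r (n - 2) ∧ cN r (n - 2) < cN r (n - 1) ∧
      cN r (n - 1) + d = r * cN r (n - 2) := by
  obtain ⟨m, rfl⟩ := Nat.exists_eq_add_of_le' hn
  have e1 : m + 4 - 3 = m + 1 := by omega
  have e2 : m + 4 - 2 = m + 2 := by omega
  have e3 : m + 4 - 1 = m + 3 := by omega
  rw [e1, e2, e3]
  have h1 := cN_cast r hr (m + 1) (by omega)
  have h2 := cN_cast r hr (m + 2) (by omega)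
  have h3 := cN_cast r hr (m + 3) (by omega)
  have l1 := c_lt r hr (m + 1)
  have l2 := c_lt r hr (m + 2)
  have h : c r (m + 3) = (r : ℤ) * c r (m + 2) - c r (m + 1) := rfl
  refine ⟨cN r (m + 1), h1, ?_, ?_, ?_⟩
  · zify; rw [h1, h2]; exact l1
  · zify; rw [h3, h2]; exact l2
  · zify; rw [h1, h2, h3, h]; ring

/-! ### Positions of vertices -/

theorem vpos_le_iff (r n : ℕ) (hr : 2 ≤ r) (hn : 4 ≤ n) (j k : ℕ) :
    vpos r n j ≤ k ↔ j * cN r (n - 1) ≤ k * cN r (n - 2) := by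
  obtain ⟨d, -, h1, h2, h3⟩ := dat r n hr hn
  unfold vpos
  rw [Nat.div_le_iff_le_mul_add_pred (by omega), mul_comm k]
  omega

theorem vpos_le_iff_hgt (r n : ℕ) (hr : 2 ≤ r) (hn : 4 ≤ n) (j k : ℕ) :
    vpos r n j ≤ k ↔ j ≤ hgt r n k := by
  obtain ⟨d, -, h1, h2, h3⟩ := dat r n hr hn
  rw [vpos_le_iff r n hr hn, hgt, Nat.le_div_iff_mul_le (by omega)]

/-- The excess `E_j`. -/
def Ex (r n j : ℕ) : ℤ := (cN r (n - 2) : ℤ) * vpos r n j - j * cN r (n - 1)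

theorem Ex_bounds (r n : ℕ) (hr : 2 ≤ r) (hn : 4 ≤ n) (j : ℕ) :
    0 ≤ Ex r n j ∧ Ex r n j < cN r (n - 2) := by
  obtain ⟨d, -, h1, h2, h3⟩ := dat r n hr hn
  have A := (vpos_le_iff r n hr hn j (vpos r n j)).1 le_rfl
  zify at A
  unfold Ex
  refine ⟨by nlinarith, ?_⟩
  rcases Nat.eq_zero_or_pos (vpos r n j) with h | h
  · rw [h]; push_cast; nlinarith
  · have B := (vpos_le_iff r n hr hn j (vpos r n j - 1)).not.1 (by omega)
    push Not at B
    zify [h] at B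
    nlinarith

theorem slopeLE_iff (r n : ℕ) (hr : 2 ≤ r) (hn : 4 ≤ n) (i t : ℕ) :
    slopeLE r n i t ↔ Ex r n i ≤ Ex r n t := by
  unfold slopeLE Ex vx
  rw [← cN_cast r hr (n-1) (by omega), ← cN_cast r hr (n-2) (by omega)]
  constructor <;> intro h <;> linarith

theorem vpos_zero (r n : ℕ) (hr : 2 ≤ r) (hn : 4 ≤ n) : vpos r n 0 = 0 := by
  have := (vpos_le_iff r n hr hn 0 0).2 (by simp)
  omega

theorem vpos_step (r n : ℕ) (hr : 2 ≤ r) (hn : 4 ≤ n) (j : ℕ) :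
    (slopeLE r n j (j+1) ∧ vpos r n (j+1) = vpos r n j + r) ∨
    (¬ slopeLE r n j (j+1) ∧ vpos r n (j+1) + 1 = vpos r n j + r) := by
  obtain ⟨d, -, h1, h2, h3⟩ := dat r n hr hn
  have A := Ex_bounds r n hr hn j
  have B := Ex_bounds r n hr hn (j+1)
  rw [slopeLE_iff r n hr hn]
  unfold Ex at *
  set b : ℕ := cN r (n-2)
  set a : ℕ := cN r (n-1)
  zify at h1 h2 h3 ⊢
  have ha : (a:ℤ) = r * b - d := by linarith
  rw [ha] at *
  push_cast at *
  set p : ℤ := (vpos r n j : ℤ)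
  set q : ℤ := (vpos r n (j+1) : ℤ)
  have hd : (0:ℤ) ≤ d := by positivity
  by_cases h : (b:ℤ) * p - j * (r * b - d) ≤ b * q - (j+1) * (r * b - d)
  · left
    refine ⟨h, ?_⟩
    have l1 : q - p - r < 1 := by
      by_contra hh; push Not at hh; nlinarith
    have l2 : -1 < q - p - r := by
      by_contra hh; push Not at hh; nlinarith
    omega
  · right
    refine ⟨h, ?_⟩
    push Not at h
    have l1 : q - p - r < 0 := by
      by_contra hh; push Not at hh; nlinarith
    have l2 : -2 < q - p - r := by
      by_contra hh; push Not at hh; nlinarith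
    omega

theorem vpos_strictMono (r n : ℕ) (hr : 2 ≤ r) (hn : 4 ≤ n) : StrictMono (vpos r n) := by
  apply strictMono_nat_of_lt_succ
  intro j
  rcases vpos_step r n hr hn j with h | h <;> omega

theorem slopeLE_zero (r n : ℕ) (hr : 2 ≤ r) (hn : 4 ≤ n) (t : ℕ) : slopeLE r n 0 t := by
  rw [slopeLE_iff r n hr hn]
  have := (Ex_bounds r n hr hn t).1
  rw [Ex, vpos_zero r n hr hn]
  simpa using this

/-! ### Colours -/

theorem rec_ge_two (r : ℕ) (hr : 2 ≤ r) (m w : ℕ) (hm : 3 ≤ m) (hw : (w:ℤ) < r - 1) :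
    2 ≤ c r m - w * c r (m - 1) := by
  obtain ⟨k, rfl⟩ := Nat.exists_eq_add_of_le' hm
  have e : k + 3 - 1 = k + 2 := by omega
  rw [e]
  have h : c r (k + 3) = (r : ℤ) * c r (k + 2) - c r (k + 1) := rfl
  have l1 := c_lt r hr (k + 1)
  have l0 := c_nonneg r hr (k+1) (by omega)
  rw [h]
  have : (w:ℤ) + 2 ≤ r := by omega
  nlinarith

set_option maxHeartbeats 1000000 in
/-- The key arithmetic fact: the first descent is at distance one or a green distance. -/
theorem descent (r n : ℕ) (hr : 2 ≤ r) (hn : 4 ≤ n) (i u : ℕ) (hu : 2 ≤ u)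
    (hlt : Ex r n (i + u) < Ex r n i)
    (hmin : ∀ y : ℕ, 1 ≤ y → y < u → Ex r n i ≤ Ex r n (i + y)) :
    ∃ m w : ℕ, 3 ≤ m ∧ m + 2 ≤ n ∧ 1 ≤ w ∧ (w:ℤ) < r - 1 ∧ (u : ℤ) = c r m - w * c r (m-1) := by
  obtain ⟨d, hd, h1, h2, h3⟩ := dat r n hr hn
  have Bi := Ex_bounds r n hr hn i
  by_contra hno
  have hb := cN_cast r hr (n-2) (by omega)
  -- drop identity
  have hdrop : ∀ y : ℕ, ∃ v : ℤ, Ex r n i - Ex r n (i+y) = v * cN r (n-2) - y * d := by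
    intro y
    unfold Ex
    refine ⟨(vpos r n i : ℤ) - vpos r n (i+y) + r * y, ?_⟩
    zify at h3
    have ha : (cN r (n-1):ℤ) = r * cN r (n-2) - d := by linarith
    rw [ha]; push_cast; ring
  -- determinant facts
  have det1 : ∀ m, 3 ≤ m → m + 2 ≤ n →
      c r (m-1) * d - c r (m-2) * cN r (n-2) = c r (n - m) ∧
      c r m * d - c r (m-1) * cN r (n-2) = c r (n - 1 - m) := by
    intro m hm hmn
    rw [hb, hd]
    constructor
    · have := c_det r (n-m-1) (m-2)
      rw [show m - 2 + 1 = m - 1 by omega, show m - 2 + (n-m-1) = n - 3 by omega,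
        show n - 3 + 1 = n - 2 by omega, show n - m - 1 + 1 = n - m by omega] at this
      exact this
    · have := c_det r (n-m-2) (m-1)
      rw [show m - 1 + 1 = m by omega, show m - 1 + (n-m-2) = n - 3 by omega,
        show n - 3 + 1 = n - 2 by omega, show n - m - 2 + 1 = n - 1 - m by omega] at this
      exact this
  have det0 : ∀ m, 3 ≤ m → c r (m-1) * c r (m-1) - c r (m-2) * c r m = 1 := by
    intro m hm
    have := c_det r 1 (m-2)
    rw [show m - 2 + 1 = m - 1 by omega, show m - 1 + 1 = m by omega] at this
    simpa [c] using this
  have hN := c_nonneg r hr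
  -- E_i is small if `u` exceeds a record
  have small : ∀ m w : ℕ, 3 ≤ m → m + 2 ≤ n → 1 ≤ w → w ≤ r - 1 →
      c r m - w * c r (m-1) < u → Ex r n i < w * c r (n-m) - c r (n-1-m) := by
    intro m w hm hmn hw hwr hlt'
    have hR : 1 ≤ c r m - w * c r (m-1) := by
      obtain ⟨k, rfl⟩ := Nat.exists_eq_add_of_le' hm
      have e : k + 3 - 1 = k + 2 := by omega
      rw [e]
      have h : c r (k + 3) = (r : ℤ) * c r (k + 2) - c r (k + 1) := rfl
      have l1 := c_lt r hr (k + 1)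
      have l0 := c_nonneg r hr (k+1) (by omega)
      have : (w:ℤ) + 1 ≤ r := by omega
      rw [h]; nlinarith
    obtain ⟨R, hRe⟩ := Int.eq_ofNat_of_zero_le (by omega : 0 ≤ c r m - w * c r (m-1))
    have hE := hmin R (by omega) (by omega)
    obtain ⟨v, hv⟩ := hdrop R
    have BR := Ex_bounds r n hr hn (i+R)
    obtain ⟨d1, d2⟩ := det1 m hm hmn
    have hD : (w:ℤ) * c r (n-m) - c r (n-1-m) =
        (c r (m-1) - w * c r (m-2)) * cN r (n-2) - R * d := by
      have : ((R:ℕ):ℤ) = c r m - w * c r (m-1) := hRe.symm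
      rw [this, ← d1, ← d2]; ring
    by_contra hcon
    push Not at hcon
    have hDpos : 0 < (w:ℤ) * c r (n-m) - c r (n-1-m) := by
      have l1 := c_lt r hr (n-1-m)
      rw [show n - 1 - m + 1 = n - m by omega] at l1
      have l0 := hN (n-1-m) (by omega)
      have : (1:ℤ) ≤ w := by exact_mod_cast hw
      nlinarith
    -- compare
    set D := (w:ℤ) * c r (n-m) - c r (n-1-m)
    set V := c r (m-1) - w * c r (m-2)
    have key : Ex r n (i+R) = (Ex r n i - D) + (V - v) * cN r (n-2) := by
      linarith
    have bpos : (0:ℤ) < cN r (n-2) := by omega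
    have : V - v ≤ 0 := by
      by_contra hh; push Not at hh
      have := mul_le_mul_of_nonneg_right (show 1 ≤ V - v from hh) bpos.le
      linarith
    have : 0 ≤ V - v := by
      by_contra hh; push Not at hh
      have := mul_le_mul_of_nonneg_right (show V - v ≤ -1 by omega) bpos.le
      linarith
    have : V - v = 0 := by omega
    rw [this] at key
    linarith
  have step : ∀ m w : ℕ, 3 ≤ m → m + 2 ≤ n → 1 ≤ w → w + 1 ≤ r - 1 →
      c r m - (w+1 : ℕ) * c r (m-1) < u → c r m - w * c r (m-1) < u := by
    intro m w hm hmn hw hwr hlt'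
    have hs := small m (w+1) hm hmn (by omega) hwr hlt'
    obtain ⟨v, hv⟩ := hdrop u
    obtain ⟨d1, d2⟩ := det1 m hm hmn
    have d0 := det0 m hm
    have hD : ((w+1:ℕ):ℤ) * c r (n-m) - c r (n-1-m) =
        (c r (m-1) - (w+1:ℕ) * c r (m-2)) * cN r (n-2) -
          (c r m - (w+1 : ℕ) * c r (m-1)) * d := by
      rw [← d1, ← d2]; ring
    have hne : (u:ℤ) ≠ c r m - w * c r (m-1) := by
      intro h
      exact hno ⟨m, w, hm, hmn, hw, by omega, h⟩
    have Bu := Ex_bounds r n hr hn (i+u)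
    have hR : 1 ≤ c r m - (w+1:ℕ) * c r (m-1) := by
      obtain ⟨k, rfl⟩ := Nat.exists_eq_add_of_le' hm
      have e : k + 3 - 1 = k + 2 := by omega
      rw [e]
      have h : c r (k + 3) = (r : ℤ) * c r (k + 2) - c r (k + 1) := rfl
      have l1 := c_lt r hr (k + 1)
      have l0 := c_nonneg r hr (k+1) (by omega)
      have : ((w+1:ℕ):ℤ) + 1 ≤ r := by omega
      rw [h]; nlinarith
    set R := c r m - (w+1:ℕ) * c r (m-1) with hRdef
    set D := ((w+1:ℕ):ℤ) * c r (n-m) - c r (n-1-m) with hDdef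
    set D' := Ex r n i - Ex r n (i+u) with hD'
    have p1 : 0 < D' := by omega
    have p2 : D' < D := by omega
    set b : ℤ := (cN r (n-2) : ℤ)
    have bpos : 0 < b := by omega
    set x := v * c r (m-1) - u * c r (m-2) with hx
    set y := u * (c r (m-1) - (w+1:ℕ) * c r (m-2)) - v * R with hy
    have xb : x * b = u * c r (n-m) + D' * c r (m-1) := by
      rw [hx, hv, ← d1]; ring
    have yb : y * b = u * D - D' * R := by
      rw [hy, hv, hD]; ring
    have cm1 : 1 ≤ c r (m-1) := by
      have l1 := c_lt r hr (m-2)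
      rw [show m - 2 + 1 = m - 1 by omega] at l1
      have l0 := hN (m-2) (by omega)
      omega
    have xpos : 0 < x := by
      have l0 := hN (n-m) (by omega)
      have : 0 < x * b := by
        rw [xb]
        have : 0 ≤ (u:ℤ) * c r (n-m) := by positivity
        nlinarith
      exact (mul_pos_iff_of_pos_right bpos).1 this
    have ypos : 0 < y := by
      have : 0 < y * b := by
        rw [yb]; nlinarith
      exact (mul_pos_iff_of_pos_right bpos).1 this
    have ueq : (u:ℤ) = x * R + y * c r (m-1) := by
      have : x * R + y * c r (m-1) = u * (c r (m-1) * c r (m-1) - c r (m-2) * c r m) := by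
        rw [hx, hy, hRdef]; ring
      rw [this, d0, mul_one]
    have hge : c r m - w * c r (m-1) ≤ u := by
      have e : c r m - w * c r (m-1) = R + c r (m-1) := by
        rw [hRdef]; push_cast; ring
      rw [e, ueq]; nlinarith
    omega
  -- descend within a level
  have level : ∀ m : ℕ, 3 ≤ m → m + 2 ≤ n → c r m - (r - 1 : ℕ) * c r (m-1) < u →
      c r m - (1:ℕ) * c r (m-1) < u := by
    intro m hm hmn h0
    have : ∀ t : ℕ, t + 1 ≤ r - 1 → c r m - (r - 1 - t : ℕ) * c r (m-1) < u := by
      intro t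
      induction t with
      | zero => intro _; exact h0
      | succ s ih =>
        intro ht
        apply step m (r-1-(s+1)) hm hmn (by omega) (by omega)
        rw [show r - 1 - (s+1) + 1 = r - 1 - s by omega]
        exact ih (by omega)
    have := this (r-2) (by omega)
    rwa [show r - 1 - (r-2) = 1 by omega] at this
  have all : ∀ m : ℕ, m + 5 ≤ n → c r (m+3) - c r (m+2) < u := by
    intro m
    induction m with
    | zero =>
      intro hmn
      have := level 3 le_rfl (by omega) (by
        have : ((r-1:ℕ):ℤ) = r - 1 := by omega
        rw [this]
        simp [c]; omega)
      simpa using this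
    | succ s ih =>
      intro hmn
      have := level (s+4) (by omega) (by omega) (by
        have e : ((r-1:ℕ):ℤ) = r - 1 := by omega
        have i1 := ih (by omega)
        have h : c r (s + 4) = (r : ℤ) * c r (s + 3) - c r (s + 2) := rfl
        rw [e, show s + 4 - 1 = s + 3 by omega, h]
        linarith)
      rw [show s + 4 - 1 = s + 3 by omega] at this
      simpa using this
  rcases Nat.lt_or_ge n 5 with h5 | h5
  · have : n = 4 := by omega
    subst this
    have : cN r (4-2) = 1 := by simp [cN, c]
    have Bu := Ex_bounds r 4 hr hn (i+u)
    rw [this] at Bi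
    omega
  · have h := all (n-5) (by omega)
    rw [show n - 5 + 3 = n - 2 by omega, show n - 5 + 2 = n - 3 by omega] at h
    have := small (n-2) 1 (by omega) (by omega) le_rfl (by omega) (by
      rw [show n - 2 - 1 = n - 3 by omega]; push_cast; linarith)
    rw [show n - (n-2) = 2 by omega, show n - 1 - (n-2) = 1 by omega] at this
    have Bu := Ex_bounds r n hr hn (i+u)
    simp [c] at this
    omega

theorem isRed_iff (r n : ℕ) (hr : 2 ≤ r) (hn : 4 ≤ n) (i k : ℕ) (hik : i < k) :
    isRed r n i k ↔ ¬ slopeLE r n i (i+1) := by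
  constructor
  · rintro ⟨hB, hG⟩ hs
    have hne : (badSet r n i k).Nonempty := Finset.nonempty_iff_ne_empty.2 hB
    set t := (badSet r n i k).min' hne with ht
    have hmem : t ∈ badSet r n i k := Finset.min'_mem _ _
    have hle : ∀ s ∈ badSet r n i k, t ≤ s := fun s hs => Finset.min'_le _ _ hs
    have hm := hmem
    simp only [badSet, Finset.mem_filter, Finset.mem_Icc] at hm
    have h1 : t ≠ i + 1 := by
      intro h; rw [h] at hm; exact hm.2 hs
    obtain ⟨u, hu⟩ := Nat.exists_eq_add_of_lt (show i < t by omega)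
    have hd := descent r n hr hn i (t - i) (by omega)
      (by
        rw [show i + (t - i) = t by omega]
        have := hm.2
        rw [slopeLE_iff r n hr hn] at this
        push Not at this; exact this)
      (by
        intro y hy1 hy2
        by_contra hcon
        have := hle (i+y) (by
          simp only [badSet, Finset.mem_filter, Finset.mem_Icc]
          refine ⟨by omega, ?_⟩
          rw [slopeLE_iff r n hr hn]; exact hcon)
        omega)
    obtain ⟨m, w, a1, a2, a3, a4, a5⟩ := hd
    exact hG ⟨m, w, a1, a2, a3, a4, t, ⟨hmem, hle⟩, by omega⟩
  · intro hs
    have hmem : i + 1 ∈ badSet r n i k := by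
      simp only [badSet, Finset.mem_filter, Finset.mem_Icc]
      exact ⟨by omega, hs⟩
    refine ⟨?_, ?_⟩
    · intro h
      rw [isBlue] at h
      rw [h] at hmem; simp at hmem
    · rintro ⟨m, w, a1, a2, a3, a4, t, ⟨b1, b2⟩, b3⟩
      have := rec_ge_two r hr m w a1 a4
      have := b2 _ hmem
      omega

/-! ### Components of a finite set -/

theorem comp_spec (V : Finset ℕ) (e : ℕ) (he : e ∈ V) :
    e ≤ compEnd V e ∧ Finset.Icc e (compEnd V e) ⊆ V ∧ compEnd V e + 1 ∉ V ∧
      ∀ g, Finset.Icc e g ⊆ V → g ≤ compEnd V e := by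
  have hbdd : BddAbove {g : ℕ | Finset.Icc e g ⊆ V} := by
    refine ⟨V.sup id + e, ?_⟩
    intro g hg
    rcases Nat.lt_or_ge g e with h | h
    · omega
    · have : g ∈ V := hg (Finset.mem_Icc.2 ⟨h, le_rfl⟩)
      have := Finset.le_sup (f := id) this
      simp only [id] at this
      omega
  have hmem : e ∈ {g : ℕ | Finset.Icc e g ⊆ V} := by simp [he]
  have h1 : compEnd V e ∈ {g : ℕ | Finset.Icc e g ⊆ V} := Nat.sSup_mem ⟨e, hmem⟩ hbdd
  have h2 : e ≤ compEnd V e := le_csSup hbdd hmem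
  refine ⟨h2, h1, ?_, fun g hg => le_csSup hbdd hg⟩
  intro hc
  have : compEnd V e + 1 ≤ compEnd V e := le_csSup hbdd (by
    intro x hx
    rw [Finset.mem_Icc] at hx
    rcases Nat.lt_or_ge (compEnd V e) x with h | h
    · rw [show x = compEnd V e + 1 by omega]; exact hc
    · exact h1 (Finset.mem_Icc.2 ⟨hx.1, h⟩))
  omega

theorem mem_starts {V : Finset ℕ} {e : ℕ} : e ∈ starts V ↔ e ∈ V ∧ e - 1 ∉ V := by
  simp [starts]

theorem exists_start (V : Finset ℕ) (h0 : 0 ∉ V) (j : ℕ) (hj : j ∈ V) :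
    ∃ e ∈ starts V, e ≤ j ∧ Finset.Icc e j ⊆ V := by
  induction j with
  | zero => exact absurd hj h0
  | succ k ih =>
    by_cases hk : k ∈ V
    · obtain ⟨e, h1, h2, h3⟩ := ih hk
      refine ⟨e, h1, by omega, ?_⟩
      intro x hx
      rw [Finset.mem_Icc] at hx
      rcases Nat.lt_or_ge k x with h | h
      · rw [show x = k + 1 by omega]; exact hj
      · exact h3 (Finset.mem_Icc.2 ⟨hx.1, h⟩)
    · exact ⟨k+1, mem_starts.2 ⟨hj, by simpa using hk⟩, le_rfl, by simpa using hj⟩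

theorem start_le (V : Finset ℕ) (h0 : 0 ∉ V) (e x j : ℕ) (he : e ∈ starts V) (hej : e ≤ j)
    (hx : Finset.Icc x j ⊆ V) : e ≤ x := by
  rw [mem_starts] at he
  by_contra h
  exact he.2 (hx (Finset.mem_Icc.2 ⟨by omega, by omega⟩))

theorem start_unique (V : Finset ℕ) (h0 : 0 ∉ V) (e e' j : ℕ) (he : e ∈ starts V)
    (he' : e' ∈ starts V) (h : e ≤ j) (h' : e' ≤ j) (hs : Finset.Icc e j ⊆ V)
    (hs' : Finset.Icc e' j ⊆ V) : e = e' :=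
  le_antisymm (start_le V h0 e e' j he h hs') (start_le V h0 e' e j he' h' hs)

theorem start_pos (V : Finset ℕ) (h0 : 0 ∉ V) (e : ℕ) (he : e ∈ starts V) : 1 ≤ e := by
  rw [mem_starts] at he
  rcases Nat.eq_zero_or_pos e with h | h
  · rw [h] at he; exact absurd he.1 h0
  · exact h

theorem comp_sep (V : Finset ℕ) (h0 : 0 ∉ V) (e e' : ℕ) (he : e ∈ starts V)
    (he' : e' ∈ starts V) (hlt : e < e') : compEnd V e + 1 < e' := by
  have s := comp_spec V e (mem_starts.1 he).1
  by_contra h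
  have h1 := mem_starts.1 he'
  apply h1.2
  exact s.2.1 (Finset.mem_Icc.2 ⟨by omega, by omega⟩)

theorem comp_decomp (V : Finset ℕ) (h0 : 0 ∉ V) :
    (starts V).biUnion (fun e => Finset.Icc e (compEnd V e)) = V := by
  ext x
  simp only [Finset.mem_biUnion]
  constructor
  · rintro ⟨e, he, hx⟩
    exact (comp_spec V e (mem_starts.1 he).1).2.1 hx
  · intro hx
    obtain ⟨e, he, h1, h2⟩ := exists_start V h0 x hx
    exact ⟨e, he, Finset.mem_Icc.2 ⟨h1, (comp_spec V e (mem_starts.1 he).1).2.2.2 _ h2⟩⟩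

theorem comp_disj (V : Finset ℕ) (h0 : 0 ∉ V) :
    (starts V : Set ℕ).PairwiseDisjoint (fun e => Finset.Icc e (compEnd V e)) := by
  intro e he e' he' hne
  simp only [Function.onFun]
  rw [Finset.disjoint_left]
  intro x hx hx'
  rw [Finset.mem_Icc] at hx hx'
  rcases lt_or_gt_of_ne hne with h | h
  · have := comp_sep V h0 e e' he he' h; omega
  · have := comp_sep V h0 e' e he' he h; omega

/-! ### Vertical edges and the map `f` -/

theorem vpos_ge (r n : ℕ) (hr : 2 ≤ r) (hn : 4 ≤ n) (i : ℕ) : r ≤ vpos r n (i+1) := by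
  rcases Nat.eq_zero_or_pos i with h | h
  · subst h
    have h1 := slopeLE_zero r n hr hn (0+1)
    have h2 := vpos_step r n hr hn 0
    rcases h2 with h2 | h2
    · omega
    · exact absurd h1 h2.1
  · have h2 := vpos_step r n hr hn i
    have h3 := vpos_strictMono r n hr hn h
    omega

theorem vpos_gap (r n : ℕ) (hr : 2 ≤ r) (hn : 4 ≤ n) (i : ℕ) :
    vpos r n i + r ≤ vpos r n (i+1) + 1 ∧ vpos r n (i+1) ≤ vpos r n i + r := by
  rcases vpos_step r n hr hn i with h | h <;> omega

theorem edges_inr (r n : ℕ) (hr : 2 ≤ r) (hn : 4 ≤ n) (i k : ℕ) (hik : i < k) :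
    edges r n (Sum.inr (i,k)) = Finset.Icc (vpos r n (i+1) + 1 - r) (vpos r n k) := by
  have h := isRed_iff r n hr hn i k hik
  have h1 := vpos_ge r n hr hn i
  simp only [edges]
  rcases vpos_step r n hr hn i with h2 | h2
  · rw [if_neg (by rw [h]; simpa using h2.1)]
    congr 1; omega
  · rw [if_pos (h.2 h2.1)]
    congr 1; omega

theorem vpos_le_a (r n : ℕ) (hr : 2 ≤ r) (hn : 4 ≤ n) (j : ℕ) :
    vpos r n j ≤ cN r (n-1) ↔ j ≤ cN r (n-2) := by
  obtain ⟨d, -, h1, h2, h3⟩ := dat r n hr hn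
  rw [vpos_le_iff r n hr hn, mul_comm (cN r (n-1))]
  exact Nat.mul_le_mul_right_iff (by omega)

theorem hgt_step (r n : ℕ) (hr : 2 ≤ r) (hn : 4 ≤ n) (k : ℕ) :
    hgt r n (k+1) ≤ hgt r n k + 1 ∧ hgt r n k ≤ hgt r n (k+1) := by
  constructor
  · by_contra h
    push Not at h
    have h1 := (vpos_le_iff_hgt r n hr hn (hgt r n k + 2) (k+1)).2 (by omega)
    have h2 := (vpos_le_iff_hgt r n hr hn (hgt r n k + 1) k).not.2 (by omega)
    have := vpos_strictMono r n hr hn (show hgt r n k + 1 < hgt r n k + 2 by omega)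
    omega
  · rw [← vpos_le_iff_hgt r n hr hn]
    have := (vpos_le_iff_hgt r n hr hn (hgt r n k) k).2 le_rfl
    omega

theorem isVert_iff (r n : ℕ) (hr : 2 ≤ r) (hn : 4 ≤ n) (k : ℕ) (hk : 1 ≤ k) :
    isVert r n k ↔ ∃ j, 1 ≤ j ∧ vpos r n j = k := by
  unfold isVert
  constructor
  · intro h
    refine ⟨hgt r n k, by omega, ?_⟩
    have h1 := (vpos_le_iff_hgt r n hr hn (hgt r n k) k).2 le_rfl
    have h2 := (vpos_le_iff_hgt r n hr hn (hgt r n k) (k-1)).not.2 (by omega)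
    omega
  · rintro ⟨j, hj, rfl⟩
    have h1 := (vpos_le_iff_hgt r n hr hn j (vpos r n j)).1 le_rfl
    have h2 := (vpos_le_iff_hgt r n hr hn j (vpos r n j - 1)).not.1 (by omega)
    omega

theorem S_succ (r n e : ℕ) : S r n (e+1) = S r n e + bseq r n (e+1) := by
  unfold S
  rw [Finset.sum_Icc_succ_top (by omega)]

theorem bseq_hgt (r n : ℕ) (hr : 2 ≤ r) (hn : 4 ≤ n) (e : ℕ) :
    bseq r n (e+1) + hgt r n (e+1) = r + hgt r n e := by
  have h := hgt_step r n hr hn e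
  unfold bseq isVert
  simp only [Nat.add_sub_cancel]
  split_ifs <;> omega

theorem bseq_pos (r n : ℕ) (hr : 2 ≤ r) (e : ℕ) : 1 ≤ bseq r n e := by
  unfold bseq
  split_ifs <;> omega

theorem S_hgt (r n : ℕ) (hr : 2 ≤ r) (hn : 4 ≤ n) (e : ℕ) :
    S r n e + hgt r n e = r * e := by
  induction e with
  | zero => simp [S, hgt]
  | succ k ih =>
    rw [S_succ]
    have := bseq_hgt r n hr hn k
    rw [Nat.mul_succ]
    omega

theorem S_strictMono (r n : ℕ) (hr : 2 ≤ r) : StrictMono (S r n) := by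
  apply strictMono_nat_of_lt_succ
  intro k
  rw [S_succ]
  have := bseq_pos r n hr (k+1)
  omega

theorem S_eq_vpos (r n : ℕ) (hr : 2 ≤ r) (hn : 4 ≤ n) (e : ℕ) :
    vpos r (n+1) e = S r n e := by
  have hn' : 4 ≤ n + 1 := by omega
  obtain ⟨d, -, h1, h2, h3⟩ := dat r n hr hn
  have hN : cN r n + cN r (n-2) = r * cN r (n-1) := by
    zify
    rw [cN_cast r hr n (by omega), cN_cast r hr (n-1) (by omega), cN_cast r hr (n-2) (by omega),
      c_rec r n (by omega)]
    ring
  have hS := S_hgt r n hr hn e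
  have key : ∀ k, vpos r (n+1) e ≤ k ↔ S r n e ≤ k := by
    intro k
    rw [vpos_le_iff r (n+1) hr hn']
    have e1 : n + 1 - 1 = n := by omega
    have e2 : n + 1 - 2 = n - 1 := by omega
    rw [e1, e2]
    have g1 : hgt r n e * cN r (n-1) ≤ e * cN r (n-2) := Nat.div_mul_le_self _ _
    have g2 : e * cN r (n-2) < (hgt r n e + 1) * cN r (n-1) := by
      exact (Nat.div_lt_iff_lt_mul (by omega)).1 (Nat.lt_succ_self _)
    zify at *
    have hc : (cN r n : ℤ) = r * cN r (n-1) - cN r (n-2) := by linarith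
    have hs : (S r n e : ℤ) = r * e - hgt r n e := by linarith
    rw [hc, hs]
    set A : ℤ := (cN r (n-1) : ℤ)
    set B : ℤ := (cN r (n-2) : ℤ)
    set H : ℤ := (hgt r n e : ℤ)
    constructor
    · intro h
      by_contra hcon
      push Not at hcon
      have : (k:ℤ) + H + 1 ≤ r * e := by omega
      have := mul_le_mul_of_nonneg_right this (show 0 ≤ A by omega)
      nlinarith
    · intro h
      have : (r:ℤ) * e ≤ k + H := by omega
      have := mul_le_mul_of_nonneg_right this (show 0 ≤ A by omega)
      nlinarith
  exact le_antisymm ((key _).2 le_rfl) ((key _).1 le_rfl)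

theorem S_top (r n : ℕ) (hr : 2 ≤ r) (hn : 4 ≤ n) : (S r n (cN r (n-1)) : ℤ) = c r n := by
  have h := S_hgt r n hr hn (cN r (n-1))
  obtain ⟨d, -, h1, h2, h3⟩ := dat r n hr hn
  have : hgt r n (cN r (n-1)) = cN r (n-2) := by
    unfold hgt
    exact Nat.mul_div_cancel_left _ (by omega)
  rw [this] at h
  zify at h
  rw [c_rec r n (by omega), ← cN_cast r hr (n-1) (by omega), ← cN_cast r hr (n-2) (by omega)]
  linarith

theorem isBG_iff (r n : ℕ) (hr : 2 ≤ r) (hn : 4 ≤ n) (e g : ℕ) (he : 1 ≤ e) (heg : e ≤ g)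
    (hg : g ≤ cN r (n-1)) :
    isBGinterval r n (S r n (e-1) + 1) (S r n g) ↔ ¬ isVert r n e := by
  have hn' : 4 ≤ n + 1 := by omega
  have red : isRed r (n+1) (e-1) g ↔ isVert r n e := by
    rw [isRed_iff r (n+1) hr hn' (e-1) g (by omega)]
    have h := vpos_step r (n+1) hr hn' (e-1)
    rw [show e - 1 + 1 = e by omega, S_eq_vpos r n hr hn, S_eq_vpos r n hr hn] at h
    have hs := S_succ r n (e-1)
    rw [show e - 1 + 1 = e by omega] at hs ⊢
    unfold bseq at hs
    split_ifs at hs with hv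
    · simp only [hv, iff_true]
      intro hh
      rcases h with h | h
      · omega
      · exact h.1 hh
    · simp only [hv, iff_false, not_not]
      rcases h with h | h
      · exact h.1
      · omega
  rw [← red]
  have sm := vpos_strictMono r (n+1) hr hn'
  constructor
  · rintro ⟨i, k, hik, hk, hnr, heq⟩
    rw [← S_eq_vpos r n hr hn, ← S_eq_vpos r n hr hn] at heq
    have l1 : vpos r (n+1) (e-1) < vpos r (n+1) g := sm (by omega)
    have l2 : vpos r (n+1) i < vpos r (n+1) k := sm hik
    have hI := congrArg (fun s : Finset ℕ => (s : Set ℕ)) heq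
    simp only [Finset.coe_Icc] at hI
    have hb := (Set.Icc_eq_Icc_iff (by omega)).1 hI
    have i1 : e - 1 = i := sm.injective (by omega)
    have i2 : g = k := sm.injective hb.2
    rw [i1, i2]; exact hnr
  · intro h
    refine ⟨e-1, g, by omega, ?_, h, ?_⟩
    · rw [← cN_cast r hr (n-1) (by omega)]; exact_mod_cast hg
    · rw [S_eq_vpos r n hr hn, S_eq_vpos r n hr hn]

theorem sum_bseq_Icc (r n e g : ℕ) (he : 1 ≤ e) (heg : e ≤ g) :
    ∑ j ∈ Finset.Icc e g, bseq r n j + S r n (e-1) = S r n g := by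
  induction g, heg using Nat.le_induction with
  | base =>
    have := S_succ r n (e-1)
    rw [show e - 1 + 1 = e by omega] at this
    simp [this, add_comm]
  | succ k hk ih =>
    rw [Finset.sum_Icc_succ_top (by omega), S_succ]
    omega

theorem card_fmap (r n : ℕ) (hr : 2 ≤ r) (hn : 4 ≤ n) (V : Finset ℕ)
    (hV : V ⊆ Finset.Icc 1 (cN r (n-1))) :
    (fmap r n V).card = ∑ j ∈ V, bseq r n j + ((starts V).filter fun e => isVert r n e).card := by
  have h0 : 0 ∉ V := fun h => by simpa using hV h
  have hsub : ∀ e ∈ starts V,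
      fcomp r n V e ⊆ Finset.Icc (S r n (e-1)) (S r n (compEnd V e)) := by
    intro e he x hx
    have h1 := start_pos V h0 e he
    have h2 := comp_spec V e (mem_starts.1 he).1
    have h3 := S_strictMono r n hr (show e - 1 < compEnd V e by omega)
    unfold fcomp at hx
    rw [Finset.mem_Icc]
    split_ifs at hx
    · rw [Finset.mem_Icc] at hx; omega
    · rw [Finset.mem_insert, Finset.mem_Icc] at hx; omega
  have hdis : ∀ e ∈ starts V, ∀ e' ∈ starts V, e < e' →
      Disjoint (fcomp r n V e) (fcomp r n V e') := by
    intro e he e' he' h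
    rw [Finset.disjoint_left]
    intro x hx hx'
    have a1 := Finset.mem_Icc.1 (hsub e he hx)
    have a2 := Finset.mem_Icc.1 (hsub e' he' hx')
    have a3 := comp_sep V h0 e e' he he' h
    have a4 := S_strictMono r n hr (show compEnd V e < e' - 1 by omega)
    omega
  unfold fmap
  rw [Finset.card_biUnion]
  swap
  · intro e he e' he' hne
    rcases lt_or_gt_of_ne hne with h | h
    · exact hdis e he e' he' h
    · exact (hdis e' he' e he h).symm
  have hsum : ∑ j ∈ V, bseq r n j =
      ∑ e ∈ starts V, ∑ j ∈ Finset.Icc e (compEnd V e), bseq r n j := by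
    conv_lhs => rw [← comp_decomp V h0]
    rw [Finset.sum_biUnion (comp_disj V h0)]
  rw [hsum, Finset.card_filter, ← Finset.sum_add_distrib]
  apply Finset.sum_congr rfl
  intro e he
  have h1 := start_pos V h0 e he
  have h2 := comp_spec V e (mem_starts.1 he).1
  have h3 := sum_bseq_Icc r n e (compEnd V e) h1 h2.1
  have h4 : compEnd V e ∈ V := h2.2.1 (Finset.mem_Icc.2 ⟨h2.1, le_rfl⟩)
  have h5 := isBG_iff r n hr hn e (compEnd V e) h1 h2.1 (Finset.mem_Icc.1 (hV h4)).2
  unfold fcomp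
  by_cases hv : isVert r n e
  · rw [if_neg (by rw [h5]; simpa using hv), if_pos hv, Finset.card_insert_of_notMem (by simp)]
    simp only [Nat.card_Icc]; omega
  · rw [if_pos (h5.2 hv), if_neg hv]
    simp only [Nat.card_Icc]; omega

/-- The index set of free vertical edges. -/
def Uset (r n : ℕ) (V : Finset ℕ) : Finset ℕ :=
  (Finset.Icc 1 (cN r (n-2))).filter
    fun j => Finset.Icc (vpos r n j + 1 - r) (vpos r n j) ⊆ V

/-- Starts of components with an early vertical edge. -/
def badStart (r n : ℕ) (V : Finset ℕ) (e : ℕ) : Prop :=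
  ∃ w : ℕ, 1 ≤ w ∧ w ≤ r - 1 ∧ Finset.Icc e (e + w - 1) ⊆ V ∧ isVert r n (e + w - 1)

theorem vpos_far (r n : ℕ) (hr : 2 ≤ r) (hn : 4 ≤ n) (i j : ℕ) (h : i < j) :
    vpos r n i + r ≤ vpos r n j + 1 := by
  have h1 := (vpos_gap r n hr hn i).1
  have h2 := (vpos_strictMono r n hr hn).monotone (show i + 1 ≤ j from h)
  omega

theorem vert_unique (r n : ℕ) (hr : 2 ≤ r) (hn : 4 ≤ n) (e w w' : ℕ) (he : 1 ≤ e) (hw : 1 ≤ w)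
    (hw' : 1 ≤ w') (hr1 : w ≤ r - 1) (hr2 : w' ≤ r - 1) (h : isVert r n (e + w - 1))
    (h' : isVert r n (e + w' - 1)) : w = w' := by
  obtain ⟨j, hj, hje⟩ := (isVert_iff r n hr hn _ (by omega)).1 h
  obtain ⟨j', hj', hje'⟩ := (isVert_iff r n hr hn _ (by omega)).1 h'
  rcases lt_trichotomy j j' with h | h | h
  · have := vpos_far r n hr hn _ _ h; omega
  · subst h; omega
  · have := vpos_far r n hr hn _ _ h; omega

theorem badStart_card (r n : ℕ) (hr : 2 ≤ r) (hn : 4 ≤ n) (V : Finset ℕ) (h0 : 0 ∉ V) :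
    ((starts V).filter (badStart r n V)).card =
      ((starts V).filter fun e => isVert r n e).card + deltaV r n V := by
  unfold deltaV
  rw [Finset.card_filter, Finset.card_filter, ← Finset.sum_add_distrib]
  apply Finset.sum_congr rfl
  intro e he
  have h1 := start_pos V h0 e he
  have hm := (mem_starts.1 he).1
  have h2 := comp_spec V e hm
  unfold deltaComp
  by_cases hd : ∃ w : ℕ, 2 ≤ w ∧ w ≤ r - 1 ∧ e + w - 1 ≤ compEnd V e ∧ isVert r n (e + w - 1)
  · obtain ⟨w, a1, a2, a3, a4⟩ := hd
    have hb : badStart r n V e := ⟨w, by omega, a2,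
      (Finset.Icc_subset_Icc_right a3).trans h2.2.1, a4⟩
    have hv : ¬ isVert r n e := by
      intro hv
      have := vert_unique r n hr hn e w 1 h1 (by omega) le_rfl a2 (by omega) a4 (by simpa using hv)
      omega
    rw [if_pos hb, if_neg hv, if_pos ⟨w, a1, a2, a3, a4⟩]
  · rw [if_neg hd]
    by_cases hv : isVert r n e
    · rw [if_pos hv, if_pos ⟨1, le_rfl, by omega, by simpa using hm, by simpa using hv⟩]
    · rw [if_neg hv, if_neg]
      rintro ⟨w, a1, a2, a3, a4⟩
      rcases Nat.lt_or_ge w 2 with h | h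
      · have : w = 1 := by omega
        subst this
        exact hv (by simpa using a4)
      · exact hd ⟨w, h, a2, h2.2.2.2 _ a3, a4⟩

theorem vert_count (r n : ℕ) (hr : 2 ≤ r) (hn : 4 ≤ n) (V : Finset ℕ)
    (hV : V ⊆ Finset.Icc 1 (cN r (n-1))) :
    (V.filter fun k => isVert r n k).card =
      (Uset r n V).card + ((starts V).filter (badStart r n V)).card := by
  have h0 : 0 ∉ V := fun h => by simpa using hV h
  have sm := vpos_strictMono r n hr hn
  have e1 : (V.filter fun k => isVert r n k) =
      ((Finset.Icc 1 (cN r (n-2))).filter fun j => vpos r n j ∈ V).image (vpos r n) := by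
    ext k
    simp only [Finset.mem_filter, Finset.mem_image, Finset.mem_Icc]
    constructor
    · rintro ⟨hk, hv⟩
      have hk' := Finset.mem_Icc.1 (hV hk)
      obtain ⟨j, hj, rfl⟩ := (isVert_iff r n hr hn k hk'.1).1 hv
      exact ⟨j, ⟨⟨hj, (vpos_le_a r n hr hn j).1 hk'.2⟩, hk⟩, rfl⟩
    · rintro ⟨j, ⟨⟨hj1, hj2⟩, hj⟩, rfl⟩
      exact ⟨hj, (isVert_iff r n hr hn _ (Finset.mem_Icc.1 (hV hj)).1).2 ⟨j, hj1, rfl⟩⟩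
  rw [e1, Finset.card_image_of_injective _ sm.injective]
  have e2 : Uset r n V = ((Finset.Icc 1 (cN r (n-2))).filter fun j => vpos r n j ∈ V).filter
      (fun j => Finset.Icc (vpos r n j + 1 - r) (vpos r n j) ⊆ V) := by
    ext j
    simp only [Uset, Finset.mem_filter]
    constructor
    · rintro ⟨h1, h2⟩
      exact ⟨⟨h1, h2 (Finset.mem_Icc.2 ⟨by omega, le_rfl⟩)⟩, h2⟩
    · rintro ⟨⟨h1, _⟩, h2⟩
      exact ⟨h1, h2⟩
  rw [e2, ← Finset.card_filter_add_card_filter_not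
    (s := (Finset.Icc 1 (cN r (n-2))).filter fun j => vpos r n j ∈ V)
    (fun j => Finset.Icc (vpos r n j + 1 - r) (vpos r n j) ⊆ V)]
  congr 1
  -- bijection from bad starts to non-free vertical edges
  have hex : ∀ j (hj : vpos r n j ∈ V), ∃ e, e ∈ starts V ∧ e ≤ vpos r n j ∧
      Finset.Icc e (vpos r n j) ⊆ V := fun j hj => exists_start V h0 (vpos r n j) hj
  choose st hst1 hst2 hst3 using hex
  have hM : ∀ j, j ∈ ((Finset.Icc 1 (cN r (n-2))).filter fun j => vpos r n j ∈ V).filter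
      (fun j => ¬ Finset.Icc (vpos r n j + 1 - r) (vpos r n j) ⊆ V) → vpos r n j ∈ V :=
    fun j hj => (Finset.mem_filter.1 (Finset.mem_filter.1 hj).1).2
  have hnear : ∀ j (hj : j ∈ ((Finset.Icc 1 (cN r (n-2))).filter fun j => vpos r n j ∈ V).filter
      (fun j => ¬ Finset.Icc (vpos r n j + 1 - r) (vpos r n j) ⊆ V)),
      vpos r n j + 1 < st j (hM j hj) + r := by
    intro j hj
    by_contra hcon
    apply (Finset.mem_filter.1 hj).2
    exact (Finset.Icc_subset_Icc_left (by omega)).trans (hst3 j (hM j hj))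
  have hvert : ∀ j, 1 ≤ j → isVert r n (vpos r n j) := by
    intro j hj
    refine (isVert_iff r n hr hn _ ?_).2 ⟨j, hj, rfl⟩
    have := sm (show 0 < j from hj)
    omega
  apply Finset.card_bij (fun j hj => st j (hM j hj))
  · intro j hj
    have h1 := hnear j hj
    have h2 := hst2 j (hM j hj)
    have h3 := start_pos V h0 _ (hst1 j (hM j hj))
    have e : st j (hM j hj) + (vpos r n j + 1 - st j (hM j hj)) - 1 = vpos r n j := by omega
    rw [Finset.mem_filter]
    refine ⟨hst1 j (hM j hj), vpos r n j + 1 - st j (hM j hj), by omega, by omega, ?_, ?_⟩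
    · rw [e]; exact hst3 j (hM j hj)
    · rw [e]
      exact hvert j (Finset.mem_Icc.1 (Finset.mem_filter.1 (Finset.mem_filter.1 hj).1).1).1
  · intro j hj j' hj' heq
    have h1 := hnear j hj
    have h2 := hst2 j (hM j hj)
    have h1' := hnear j' hj'
    have h2' := hst2 j' (hM j' hj')
    rcases lt_trichotomy j j' with h | h | h
    · have := vpos_far r n hr hn _ _ h; omega
    · exact h
    · have := vpos_far r n hr hn _ _ h; omega
  · intro e he
    rw [Finset.mem_filter] at he
    obtain ⟨hs, w, w1, w2, w3, w4⟩ := he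
    have hp := start_pos V h0 e hs
    obtain ⟨j, hj, hje⟩ := (isVert_iff r n hr hn _ (by omega)).1 w4
    have hjV : vpos r n j ∈ V := by
      rw [hje]; exact w3 (Finset.mem_Icc.2 ⟨by omega, le_rfl⟩)
    have hmem : j ∈ ((Finset.Icc 1 (cN r (n-2))).filter fun j => vpos r n j ∈ V).filter
        (fun j => ¬ Finset.Icc (vpos r n j + 1 - r) (vpos r n j) ⊆ V) := by
      rw [Finset.mem_filter, Finset.mem_filter, Finset.mem_Icc]
      refine ⟨⟨⟨hj, (vpos_le_a r n hr hn j).1 (Finset.mem_Icc.1 (hV hjV)).2⟩, hjV⟩, ?_⟩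
      intro hsub
      have := start_le V h0 e _ (vpos r n j) hs (by omega) hsub
      have h3 := vpos_ge r n hr hn (j-1)
      rw [show j - 1 + 1 = j by omega] at h3
      omega
    refine ⟨j, hmem, ?_⟩
    exact start_unique V h0 _ e (vpos r n j) (hst1 j hjV) hs (hst2 j hjV) (by omega)
      (hst3 j hjV) (by rw [hje]; exact w3)

theorem card_main (r n : ℕ) (hr : 2 ≤ r) (hn : 4 ≤ n) (V : Finset ℕ)
    (hV : V ⊆ Finset.Icc 1 (cN r (n-1))) :
    (fmap r n V).card + deltaV r n V + (Uset r n V).card = r * V.card := by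
  have h0 : 0 ∉ V := fun h => by simpa using hV h
  have h1 := card_fmap r n hr hn V hV
  have h2 := vert_count r n hr hn V hV
  have h3 := badStart_card r n hr hn V h0
  have h4 : ∑ j ∈ V, bseq r n j + (V.filter fun k => isVert r n k).card = r * V.card := by
    rw [Finset.card_filter, ← Finset.sum_add_distrib, mul_comm, ← smul_eq_mul]
    apply Finset.sum_const_nat ?_ |>.trans
    · rfl
    · intro j hj
      unfold bseq
      split_ifs <;> omega
  omega

theorem card_bound (r n : ℕ) (hr : 2 ≤ r) (hn : 4 ≤ n) (V : Finset ℕ)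
    (hV : V ⊆ Finset.Icc 1 (cN r (n-1))) :
    ((fmap r n V).card : ℤ) + deltaV r n V ≤ c r n := by
  have h0 : 0 ∉ V := fun h => by simpa using hV h
  have h1 := card_fmap r n hr hn V hV
  have h3 := badStart_card r n hr hn V h0
  rw [← S_top r n hr hn]
  have h4 : ∑ j ∈ Finset.Icc 1 (cN r (n-1)) \ V, bseq r n j + ∑ j ∈ V, bseq r n j
      = S r n (cN r (n-1)) := Finset.sum_sdiff hV
  have h5 : (Finset.Icc 1 (cN r (n-1)) \ V).card ≤
      ∑ j ∈ Finset.Icc 1 (cN r (n-1)) \ V, bseq r n j := by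
    rw [Finset.card_eq_sum_ones]
    exact Finset.sum_le_sum fun j _ => bseq_pos r n hr j
  have h6 : ((starts V).filter (badStart r n V)).card ≤ (Finset.Icc 1 (cN r (n-1)) \ V).card := by
    apply Finset.card_le_card_of_injOn (fun e => e - 1)
    · intro e he
      rw [Finset.mem_coe, Finset.mem_filter] at he
      obtain ⟨hs, w, w1, w2, w3, w4⟩ := he
      have hp := start_pos V h0 e hs
      obtain ⟨j, hj, hje⟩ := (isVert_iff r n hr hn _ (by omega)).1 w4
      have h3 := vpos_ge r n hr hn (j-1)
      rw [show j - 1 + 1 = j by omega] at h3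
      have hm := mem_starts.1 hs
      have := Finset.mem_Icc.1 (hV hm.1)
      simp only [Finset.coe_sdiff, Set.mem_diff, Finset.mem_coe, Finset.mem_Icc]
      exact ⟨by omega, hm.2⟩
    · intro e he e' he' h
      rw [Finset.mem_coe, Finset.mem_filter] at he he'
      have hp := start_pos V h0 e he.1
      have hp' := start_pos V h0 e' he'.1
      simp only at h
      omega
  zify at *
  linarith

/-! ### The bijection between collections and subsets of free vertical edges -/

/-- The set of heights spanned by an element. -/
def seg : Elt → Finset ℕ
  | Sum.inl _ => ∅
  | Sum.inr (i, k) => Finset.Ioc i k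

/-- The set of heights spanned by a collection. -/
def Tof (β : Finset Elt) : Finset ℕ := β.biUnion seg

/-- The runs of `T`, as paths. -/
def runs (T : Finset ℕ) : Finset Elt :=
  (starts T).image fun e => (Sum.inr (e - 1, compEnd T e) : Elt)

/-- The collection covering `V` whose paths are the runs of `T`. -/
def Bof (r n : ℕ) (V T : Finset ℕ) : Finset Elt :=
  runs T ∪ (V \ (runs T).biUnion (edges r n)).image (fun j => (Sum.inl j : Elt))

theorem mem_Tof (β : Finset Elt) (x : ℕ) :
    x ∈ Tof β ↔ ∃ i k, (Sum.inr (i,k) : Elt) ∈ β ∧ i < x ∧ x ≤ k := by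
  simp only [Tof, Finset.mem_biUnion]
  constructor
  · rintro ⟨p, hp, hx⟩
    rcases p with j | ⟨i, k⟩
    · simp [seg] at hx
    · exact ⟨i, k, hp, Finset.mem_Ioc.1 hx⟩
  · rintro ⟨i, k, h, hx⟩
    exact ⟨_, h, Finset.mem_Ioc.2 hx⟩

theorem mem_runs (T : Finset ℕ) (p : Elt) :
    p ∈ runs T ↔ ∃ e ∈ starts T, p = Sum.inr (e - 1, compEnd T e) := by
  simp only [runs, Finset.mem_image, eq_comm]

theorem vpos_mem_edges (r n : ℕ) (hr : 2 ≤ r) (hn : 4 ≤ n) (i k j : ℕ) (h1 : i < j) (h2 : j ≤ k) :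
    vpos r n j ∈ edges r n (Sum.inr (i,k)) := by
  rw [edges_inr r n hr hn i k (by omega), Finset.mem_Icc]
  have m := (vpos_strictMono r n hr hn).monotone
  have a1 := m (show i + 1 ≤ j from h1)
  have a2 := m h2
  omega

theorem coll_sep (r n : ℕ) (hr : 2 ≤ r) (hn : 4 ≤ n) (β : Finset Elt) (hβ : validColl r n β)
    (i k i' k' : ℕ) (h : (Sum.inr (i,k) : Elt) ∈ β) (h' : (Sum.inr (i',k') : Elt) ∈ β)
    (hne : (i,k) ≠ (i',k')) : k < i' ∨ k' < i := by
  obtain ⟨v1, v2, v3⟩ := hβ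
  by_contra hcon
  push Not at hcon
  have t := v3 i k i' k' h h'
  have a := (v1 _ h).1
  have a' := (v1 _ h').1
  have hd := v2 _ h _ h' (by intro hh; exact hne (Sum.inr.inj hh))
  have m1 := vpos_mem_edges r n hr hn i k (max i i' + 1) (by omega) (by omega)
  have m2 := vpos_mem_edges r n hr hn i' k' (max i i' + 1) (by omega) (by omega)
  exact Finset.disjoint_left.1 hd m1 m2

theorem Tof_zero (β : Finset Elt) : 0 ∉ Tof β := by
  rw [mem_Tof]
  rintro ⟨i, k, -, h, -⟩
  omega

theorem Tof_start (r n : ℕ) (hr : 2 ≤ r) (hn : 4 ≤ n) (β : Finset Elt) (hβ : validColl r n β)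
    (i k : ℕ) (h : (Sum.inr (i,k) : Elt) ∈ β) :
    i + 1 ∈ starts (Tof β) ∧ compEnd (Tof β) (i+1) = k := by
  have hik : i < k := (hβ.1 _ h).1
  have m1 : i + 1 ∈ Tof β := (mem_Tof β _).2 ⟨i, k, h, by omega, by omega⟩
  have n1 : i ∉ Tof β := by
    rw [mem_Tof]
    rintro ⟨i', k', h', a, b⟩
    have hne : (i,k) ≠ (i',k') := by
      intro hh; rw [Prod.mk.injEq] at hh; omega
    have := coll_sep r n hr hn β hβ i k i' k' h h' hne
    have := (hβ.2.2 i k i' k' h h')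
    omega
  have n2 : k + 1 ∉ Tof β := by
    rw [mem_Tof]
    rintro ⟨i', k', h', a, b⟩
    have hne : (i,k) ≠ (i',k') := by
      intro hh; rw [Prod.mk.injEq] at hh; omega
    have := coll_sep r n hr hn β hβ i k i' k' h h' hne
    have := (hβ.2.2 i k i' k' h h')
    omega
  refine ⟨mem_starts.2 ⟨m1, by simpa using n1⟩, ?_⟩
  have s := comp_spec (Tof β) (i+1) m1
  have l1 := s.2.2.2 k (by
    intro x hx
    rw [Finset.mem_Icc] at hx
    exact (mem_Tof β _).2 ⟨i, k, h, by omega, by omega⟩)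
  by_contra hne
  exact n2 (s.2.1 (Finset.mem_Icc.2 ⟨by omega, by omega⟩))

theorem mem_inr_iff (r n : ℕ) (hr : 2 ≤ r) (hn : 4 ≤ n) (β : Finset Elt) (hβ : validColl r n β)
    (q : ℕ × ℕ) : (Sum.inr q : Elt) ∈ β ↔ (Sum.inr q : Elt) ∈ runs (Tof β) := by
  obtain ⟨i, k⟩ := q
  rw [mem_runs]
  constructor
  · intro h
    obtain ⟨h1, h2⟩ := Tof_start r n hr hn β hβ i k h
    exact ⟨i+1, h1, by rw [h2]; rfl⟩
  · rintro ⟨e, he, heq⟩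
    have hm := mem_starts.1 he
    obtain ⟨i', k', h', a, b⟩ := (mem_Tof β e).1 hm.1
    have hei : e = i' + 1 := by
      by_contra hne
      exact hm.2 ((mem_Tof β _).2 ⟨i', k', h', by omega, by omega⟩)
    obtain ⟨h1, h2⟩ := Tof_start r n hr hn β hβ i' k' h'
    rw [heq, hei, h2]
    exact h'

theorem inr_runs (T : Finset ℕ) (p : Elt) (hp : p ∈ runs T) : ∃ q, p = Sum.inr q := by
  obtain ⟨e, -, rfl⟩ := (mem_runs T p).1 hp
  exact ⟨_, rfl⟩

theorem Bof_Tof (r n : ℕ) (hr : 2 ≤ r) (hn : 4 ≤ n) (β : Finset Elt) (hβ : validColl r n β) :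
    Bof r n (β.biUnion (edges r n)) (Tof β) = β := by
  have hq := mem_inr_iff r n hr hn β hβ
  ext p
  simp only [Bof, Finset.mem_union, Finset.mem_image, Finset.mem_sdiff, Finset.mem_biUnion]
  rcases p with j | q
  · constructor
    · rintro (h | ⟨j', ⟨⟨p, hp, hpe⟩, hno⟩, heq⟩)
      · obtain ⟨q, hq⟩ := inr_runs _ _ h
        cases hq
      · cases heq
        rcases p with j' | q
        · simp only [edges, Finset.mem_singleton] at hpe
          rw [hpe]; exact hp
        · exact absurd ⟨_, (hq q).1 hp, hpe⟩ hno
    · intro h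
      right
      refine ⟨j, ⟨⟨_, h, by simp [edges]⟩, ?_⟩, rfl⟩
      rintro ⟨p, hp, hpe⟩
      obtain ⟨q, rfl⟩ := inr_runs _ _ hp
      have := hβ.2.1 _ h _ ((hq q).2 hp) (by simp)
      exact Finset.disjoint_left.1 this (by simp [edges]) hpe
  · rw [hq q]
    constructor
    · rintro (h | ⟨j', -, heq⟩)
      · exact h
      · cases heq
    · exact Or.inl

theorem Tof_sub (r n : ℕ) (hr : 2 ≤ r) (hn : 4 ≤ n) (β : Finset Elt) (hβ : validColl r n β) :
    Tof β ⊆ Uset r n (β.biUnion (edges r n)) := by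
  intro j hj
  obtain ⟨i, k, h, h1, h2⟩ := (mem_Tof β j).1 hj
  have hv : i < k ∧ (k:ℤ) ≤ c r (n-2) := hβ.1 _ h
  have hv2 := hv.2
  rw [← cN_cast r hr (n-2) (by omega)] at hv2
  rw [Uset, Finset.mem_filter, Finset.mem_Icc]
  refine ⟨⟨by omega, by omega⟩, ?_⟩
  intro x hx
  rw [Finset.mem_Icc] at hx
  rw [Finset.mem_biUnion]
  refine ⟨_, h, ?_⟩
  rw [edges_inr r n hr hn i k hv.1, Finset.mem_Icc]
  have m := (vpos_strictMono r n hr hn).monotone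
  have a1 := m (show i + 1 ≤ j from h1)
  have a2 := m h2
  omega

theorem B1_eq (r n : ℕ) (hr : 2 ≤ r) (hn : 4 ≤ n) (β : Finset Elt) (hβ : validColl r n β) :
    B1 β = (Tof β).card := by
  unfold B1 Tof
  rw [Finset.card_biUnion]
  · apply Finset.sum_congr rfl
    intro p hp
    rcases p with j | ⟨i, k⟩ <;> simp [wt1, seg]
  · intro p hp q hq hne
    change Disjoint (seg p) (seg q)
    rcases p with j | ⟨i, k⟩
    · simp [seg]
    · rcases q with j' | ⟨i', k'⟩
      · simp [seg]
      · have := coll_sep r n hr hn β hβ i k i' k' hp hq (by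
          intro hh; exact hne (by rw [hh]))
        rw [Finset.disjoint_left]
        intro x hx hx'
        simp only [seg, Finset.mem_Ioc] at hx hx'
        omega

theorem Tof_Bof (r n : ℕ) (V T : Finset ℕ) (h0 : 0 ∉ T) : Tof (Bof r n V T) = T := by
  ext x
  rw [mem_Tof]
  constructor
  · rintro ⟨i, k, h, h1, h2⟩
    simp only [Bof, Finset.mem_union, Finset.mem_image] at h
    rcases h with h | ⟨j, -, hj⟩
    · obtain ⟨e, he, heq⟩ := (mem_runs T _).1 h
      rw [Sum.inr.injEq, Prod.mk.injEq] at heq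
      exact (comp_spec T e (mem_starts.1 he).1).2.1 (Finset.mem_Icc.2 ⟨by omega, by omega⟩)
    · cases hj
  · intro hx
    obtain ⟨e, he, h1, h2⟩ := exists_start T h0 x hx
    have hp := start_pos T h0 e he
    refine ⟨e-1, compEnd T e, ?_, by omega, (comp_spec T e (mem_starts.1 he).1).2.2.2 _ h2⟩
    exact Finset.mem_union_left _ ((mem_runs T _).2 ⟨e, he, rfl⟩)

theorem runs_cover (r n : ℕ) (hr : 2 ≤ r) (hn : 4 ≤ n) (V T : Finset ℕ) (hT : T ⊆ Uset r n V) :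
    (runs T).biUnion (edges r n) ⊆ V := by
  have h0 : 0 ∉ T := fun h => by simpa [Uset] using hT h
  intro x hx
  rw [Finset.mem_biUnion] at hx
  obtain ⟨p, hp, hx⟩ := hx
  obtain ⟨e, he, rfl⟩ := (mem_runs T p).1 hp
  have hp := start_pos T h0 e he
  have s := comp_spec T e (mem_starts.1 he).1
  rw [edges_inr r n hr hn _ _ (by omega), Finset.mem_Icc, show e - 1 + 1 = e by omega] at hx
  have hU : ∀ j, e ≤ j → j ≤ compEnd T e → Finset.Icc (vpos r n j + 1 - r) (vpos r n j) ⊆ V := by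
    intro j h1 h2
    exact (Finset.mem_filter.1 (hT (s.2.1 (Finset.mem_Icc.2 ⟨h1, h2⟩)))).2
  have key : ∀ k, e ≤ k → k ≤ compEnd T e → x ≤ vpos r n k → x ∈ V := by
    intro k hk
    induction k, hk using Nat.le_induction with
    | base =>
      intro h1 h2
      exact hU e le_rfl h1 (Finset.mem_Icc.2 ⟨hx.1, h2⟩)
    | succ k hk ih =>
      intro h1 h2
      rcases Nat.lt_or_ge (vpos r n k) x with h | h
      · apply hU (k+1) (by omega) h1
        have := (vpos_gap r n hr hn k).2
        exact Finset.mem_Icc.2 ⟨by omega, h2⟩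
      · exact ih (by omega) h
  exact key _ s.1 le_rfl hx.2

theorem Bof_cover (r n : ℕ) (hr : 2 ≤ r) (hn : 4 ≤ n) (V T : Finset ℕ) (hT : T ⊆ Uset r n V) :
    (Bof r n V T).biUnion (edges r n) = V := by
  have h := runs_cover r n hr hn V T hT
  unfold Bof
  rw [Finset.union_biUnion, Finset.image_biUnion]
  have : (V \ (runs T).biUnion (edges r n)).biUnion (fun j => edges r n (Sum.inl j)) =
      V \ (runs T).biUnion (edges r n) := by
    ext x; simp [edges]
  rw [this]
  exact Finset.union_sdiff_of_subset h

theorem Bof_valid (r n : ℕ) (hr : 2 ≤ r) (hn : 4 ≤ n) (V T : Finset ℕ)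
    (hV : V ⊆ Finset.Icc 1 (cN r (n-1))) (hT : T ⊆ Uset r n V) :
    validColl r n (Bof r n V T) := by
  have h0 : 0 ∉ T := fun h => by simpa [Uset] using hT h
  have hsep : ∀ e ∈ starts T, ∀ e' ∈ starts T, e < e' →
      Disjoint (edges r n (Sum.inr (e-1, compEnd T e)))
        (edges r n (Sum.inr (e'-1, compEnd T e'))) := by
    intro e he e' he' hlt
    have hp := start_pos T h0 e he
    have s := comp_spec T e (mem_starts.1 he).1
    have s' := comp_spec T e' (mem_starts.1 he').1
    have sp := comp_sep T h0 e e' he he' hlt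
    rw [edges_inr r n hr hn _ _ (by omega), edges_inr r n hr hn _ _ (by omega),
      Finset.disjoint_left]
    intro x hx hx'
    rw [Finset.mem_Icc] at hx hx'
    have a := (vpos_gap r n hr hn (e'-1)).1
    have b := vpos_strictMono r n hr hn (show compEnd T e < e' - 1 by omega)
    omega
  have hsingle : ∀ j ∈ V \ (runs T).biUnion (edges r n), ∀ p ∈ runs T, j ∉ edges r n p := by
    intro j hj p hp hjp
    exact (Finset.mem_sdiff.1 hj).2 (Finset.mem_biUnion.2 ⟨p, hp, hjp⟩)
  refine ⟨?_, ?_, ?_⟩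
  · intro p hp
    simp only [Bof, Finset.mem_union, Finset.mem_image] at hp
    rcases hp with hp | ⟨j, hj, rfl⟩
    · obtain ⟨e, he, rfl⟩ := (mem_runs T p).1 hp
      have hp := start_pos T h0 e he
      have s := comp_spec T e (mem_starts.1 he).1
      have hm := hT (s.2.1 (Finset.mem_Icc.2 ⟨s.1, le_rfl⟩))
      rw [Uset, Finset.mem_filter, Finset.mem_Icc] at hm
      refine ⟨by omega, ?_⟩
      rw [← cN_cast r hr (n-2) (by omega)]
      exact_mod_cast hm.1.2
    · have := Finset.mem_Icc.1 (hV (Finset.mem_sdiff.1 hj).1)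
      refine ⟨this.1, ?_⟩
      rw [← cN_cast r hr (n-1) (by omega)]
      exact_mod_cast this.2
  · intro p hp q hq hne
    simp only [Bof, Finset.mem_union, Finset.mem_image] at hp hq
    rcases hp with hp | ⟨j, hj, rfl⟩
    · rcases hq with hq | ⟨j', hj', rfl⟩
      · obtain ⟨e, he, rfl⟩ := (mem_runs T p).1 hp
        obtain ⟨e', he', rfl⟩ := (mem_runs T q).1 hq
        rcases lt_trichotomy e e' with h | h | h
        · exact hsep e he e' he' h
        · subst h; exact absurd rfl hne
        · exact (hsep e' he' e he h).symm
      · rw [show edges r n (Sum.inl j') = {j'} from rfl, Finset.disjoint_singleton_right]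
        exact hsingle j' hj' p hp
    · rcases hq with hq | ⟨j', hj', rfl⟩
      · rw [show edges r n (Sum.inl j) = {j} from rfl, Finset.disjoint_singleton_left]
        exact hsingle j hj q hq
      · rw [show edges r n (Sum.inl j) = {j} from rfl, show edges r n (Sum.inl j') = {j'} from rfl,
          Finset.disjoint_singleton]
        intro h; subst h; exact hne rfl
  · intro i k i' k' hp hq
    simp only [Bof, Finset.mem_union, Finset.mem_image] at hp hq
    rcases hp with hp | ⟨j, hj, hh⟩
    swap
    · cases hh
    rcases hq with hq | ⟨j, hj, hh⟩
    swap
    · cases hh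
    obtain ⟨e, he, heq⟩ := (mem_runs T _).1 hp
    obtain ⟨e', he', heq'⟩ := (mem_runs T _).1 hq
    rw [Sum.inr.injEq, Prod.mk.injEq] at heq heq'
    have s := comp_spec T e (mem_starts.1 he).1
    have s' := comp_spec T e' (mem_starts.1 he').1
    have p1 := start_pos T h0 e he
    have p2 := start_pos T h0 e' he'
    rcases lt_trichotomy e e' with h | h | h
    · have := comp_sep T h0 e e' he he' h; omega
    · subst h; omega
    · have := comp_sep T h0 e' e he' he h; omega

theorem cover_sub (r n : ℕ) (hr : 2 ≤ r) (hn : 4 ≤ n) (β : Finset Elt) (hβ : validColl r n β) :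
    β.biUnion (edges r n) ⊆ Finset.Icc 1 (cN r (n-1)) := by
  intro x hx
  obtain ⟨p, hp, hx⟩ := Finset.mem_biUnion.1 hx
  have hv := hβ.1 p hp
  rw [Finset.mem_Icc]
  rcases p with j | ⟨i, k⟩
  · have hv : 1 ≤ j ∧ (j:ℤ) ≤ c r (n-1) := hv
    rw [← cN_cast r hr (n-1) (by omega)] at hv
    simp only [edges, Finset.mem_singleton] at hx
    omega
  · have hv : i < k ∧ (k:ℤ) ≤ c r (n-2) := hv
    rw [← cN_cast r hr (n-2) (by omega)] at hv
    rw [edges_inr r n hr hn i k hv.1, Finset.mem_Icc] at hx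
    have h1 := vpos_ge r n hr hn i
    have h2 := (vpos_le_a r n hr hn k).2 (by exact_mod_cast hv.2)
    omega

theorem Ftilde_finite (r n : ℕ) (hr : 2 ≤ r) (hn : 4 ≤ n) : (Ftilde r n).Finite := by
  set A : Finset Elt := (Finset.Icc 1 (cN r (n-1))).disjSum
    (Finset.range (cN r (n-2)) ×ˢ Finset.range (cN r (n-2) + 1)) with hA
  apply (A.powerset.finite_toSet).subset
  intro β hβ
  rw [Finset.mem_coe, Finset.mem_powerset]
  intro p hp
  have hv := hβ.1 p hp
  rcases p with j | ⟨i, k⟩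
  · have hv : 1 ≤ j ∧ (j:ℤ) ≤ c r (n-1) := hv
    rw [← cN_cast r hr (n-1) (by omega)] at hv
    rw [hA, Finset.inl_mem_disjSum, Finset.mem_Icc]
    omega
  · have hv : i < k ∧ (k:ℤ) ≤ c r (n-2) := hv
    rw [← cN_cast r hr (n-2) (by omega)] at hv
    rw [hA, Finset.inr_mem_disjSum, Finset.mem_product, Finset.mem_range, Finset.mem_range]
    simp only
    omega

theorem fiber_sum (r n : ℕ) (hr : 2 ≤ r) (hn : 4 ≤ n) (V : Finset ℕ)
    (hV : V ⊆ Finset.Icc 1 (cN r (n-1))) (X : K) :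
    ∑ β ∈ (Ftilde_finite r n hr hn).toFinset.filter (fun β => β.biUnion (edges r n) = V),
      X ^ (B1 β) = (1 + X) ^ (Uset r n V).card := by
  rw [← Finset.prod_const, Finset.prod_one_add]
  apply Finset.sum_bij' (i := fun β _ => Tof β) (j := fun T _ => Bof r n V T)
  · intro β hβ
    rw [Finset.mem_filter, Set.Finite.mem_toFinset] at hβ
    rw [Finset.mem_powerset, ← hβ.2]
    exact Tof_sub r n hr hn β hβ.1
  · intro T hT
    rw [Finset.mem_powerset] at hT
    rw [Finset.mem_filter, Set.Finite.mem_toFinset]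
    exact ⟨Bof_valid r n hr hn V T hV hT, Bof_cover r n hr hn V T hT⟩
  · intro β hβ
    rw [Finset.mem_filter, Set.Finite.mem_toFinset] at hβ
    rw [← hβ.2]
    exact Bof_Tof r n hr hn β hβ.1
  · intro T hT
    rw [Finset.mem_powerset] at hT
    exact Tof_Bof r n V T (fun h => by simpa [Uset] using hT h)
  · intro β hβ
    rw [Finset.mem_filter, Set.Finite.mem_toFinset] at hβ
    rw [Finset.prod_const, B1_eq r n hr hn β hβ.1]

/-! ### Field computations -/

theorem x1_ne : x₁ ≠ 0 := by
  unfold x₁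
  rw [Ne, FaithfulSMul.algebraMap_eq_zero_iff]
  exact MvPolynomial.X_ne_zero 0

theorem x2_ne : x₂ ≠ 0 := by
  unfold x₂
  rw [Ne, FaithfulSMul.algebraMap_eq_zero_iff]
  exact MvPolynomial.X_ne_zero 1

theorem gbinom_eq (N k : ℕ) : gbinom N k = (N.choose k : ℚ) := by
  unfold gbinom
  rw [if_neg (by omega), Int.toNat_natCast]
  have h : ∏ i ∈ Finset.range k, (((N:ℤ):ℚ) - (i:ℚ)) = (N.descFactorial k : ℚ) := by
    induction k with
    | zero => simp
    | succ k ih =>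
      rw [Finset.prod_range_succ, ih, Nat.descFactorial_succ]
      rcases Nat.lt_or_ge N k with h | h
      · rw [Nat.descFactorial_eq_zero_iff_lt.2 h]; simp
      · push_cast [Nat.cast_sub h]; ring
  rw [h, Nat.choose_eq_descFactorial_div_factorial,
    Nat.cast_div (Nat.factorial_dvd_descFactorial N k) (by positivity)]

theorem gbinom_neg (A B : ℤ) (hB : B < 0) : gbinom A B = 0 := by
  unfold gbinom; rw [if_pos hB]

theorem inner_sum (r N δ : ℕ) (a : K) (x : K) :
    (∑ᶠ h : ℤ, ((gbinom N (h - δ) : ℚ) : K) * a * x ^ ((r:ℤ) * ((N:ℤ) + δ - h))) =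
      a * (1 + x ^ r) ^ N := by
  set emb : ℕ ↪ ℤ := ⟨fun k => (k:ℤ) + δ, fun p q h => by simpa using h⟩ with hemb
  rw [finsum_eq_sum_of_support_subset (s := (Finset.range (N+1)).map emb)]
  · rw [Finset.sum_map, add_pow, Finset.mul_sum]
    apply Finset.sum_congr rfl
    intro k hk
    rw [Finset.mem_range] at hk
    have e : emb k = (k:ℤ) + δ := rfl
    rw [e, add_sub_cancel_right, gbinom_eq]
    have : (r:ℤ) * ((N:ℤ) + δ - (k + δ)) = ((r * (N - k) : ℕ) : ℤ) := by
      push_cast [Nat.cast_sub (show k ≤ N by omega)]; ring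
    rw [this, zpow_natCast, pow_mul, one_pow]
    push_cast
    ring
  · intro h hh
    rw [Function.mem_support] at hh
    rw [Finset.coe_map, Set.mem_image]
    by_contra hcon
    apply hh
    have : gbinom N (h - δ) = 0 := by
      rcases lt_or_ge (h - δ) 0 with h1 | h1
      · exact gbinom_neg _ _ h1
      · obtain ⟨k, hk⟩ := Int.eq_ofNat_of_zero_le h1
        rw [hk, gbinom_eq]
        have : N < k := by
          by_contra hle
          exact hcon ⟨k, by simp; omega, by
            change (k:ℤ) + δ = h
            omega⟩
        rw [Nat.choose_eq_zero_of_lt this]; simp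
    rw [this]; simp

end

theorem F_of_z_formula (r : ℕ) (hr : 2 ≤ r) (F : K →+* K) (hF1 : F x₁ = x₂) (hF2 : F x₂ = (1 + x₂ ^ r) / x₁)
    (n : ℕ) (hn : 4 ≤ n) :
    F (zF r n) = x₁ ^ (-(c r n)) * x₂ ^ (-(c r (n - 1))) *
      ∑ V ∈ (Finset.Icc 1 (cN r (n - 1))).powerset,
        ∑ᶠ h : ℤ,
          ((gbinom (c r n - ((fmap r n V).card : ℤ) - (deltaV r n V : ℤ))
              (h - (deltaV r n V : ℤ)) : ℚ) : K) *
            x₁ ^ ((r : ℤ) * (V.card : ℤ)) *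
            x₂ ^ ((r : ℤ) * (c r n - ((fmap r n V).card : ℤ) - h)) := by
  have hx1 := x1_ne
  have hx2 := x2_ne
  have hY : (1 + x₂ ^ r) ≠ 0 := by
    intro h
    have h2 : F x₂ = 0 := by rw [hF2, h, zero_div]
    exact hx2 ((map_eq_zero F).1 h2)
  -- the right-hand side
  have hR : ∀ V ∈ (Finset.Icc 1 (cN r (n - 1))).powerset,
      (∑ᶠ h : ℤ,
          ((gbinom (c r n - ((fmap r n V).card : ℤ) - (deltaV r n V : ℤ))
              (h - (deltaV r n V : ℤ)) : ℚ) : K) *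
            x₁ ^ ((r : ℤ) * (V.card : ℤ)) *
            x₂ ^ ((r : ℤ) * (c r n - ((fmap r n V).card : ℤ) - h))) =
      ∑ β ∈ (Ftilde_finite r n hr hn).toFinset.filter (fun β => β.biUnion (edges r n) = V),
        x₁ ^ ((r : ℤ) * (B2 r n β : ℤ)) * (1 + x₂ ^ r) ^ (c r n - (r : ℤ) * (B2 r n β : ℤ)) *
          (x₂ ^ r) ^ (B1 β) := by
    intro V hV
    rw [Finset.mem_powerset] at hV
    have hb := card_bound r n hr hn V hV
    have hm := card_main r n hr hn V hV
    obtain ⟨N, hN⟩ := Int.eq_ofNat_of_zero_le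
      (show 0 ≤ c r n - ((fmap r n V).card : ℤ) - (deltaV r n V : ℤ) by linarith)
    have e : c r n - ((fmap r n V).card : ℤ) = (N : ℤ) + deltaV r n V := by linarith
    rw [hN, e]
    have hi := inner_sum r N (deltaV r n V) (x₁ ^ ((r : ℤ) * (V.card : ℤ))) x₂
    refine hi.trans ?_
    have hs : ∀ β ∈ (Ftilde_finite r n hr hn).toFinset.filter
        (fun β => β.biUnion (edges r n) = V),
        x₁ ^ ((r : ℤ) * (B2 r n β : ℤ)) * (1 + x₂ ^ r) ^ (c r n - (r : ℤ) * (B2 r n β : ℤ)) *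
          (x₂ ^ r) ^ (B1 β) =
        x₁ ^ ((r : ℤ) * (V.card : ℤ)) * (1 + x₂ ^ r) ^ (c r n - (r : ℤ) * (V.card : ℤ)) *
          (x₂ ^ r) ^ (B1 β) := by
      intro β hβ
      have : B2 r n β = V.card := by
        rw [B2, (Finset.mem_filter.1 hβ).2]
      rw [this]
    rw [Finset.sum_congr rfl hs, ← Finset.mul_sum, fiber_sum r n hr hn V hV, mul_assoc,
      ← zpow_natCast (1 + x₂ ^ r) (Uset r n V).card, ← zpow_add₀ hY,
      ← zpow_natCast (1 + x₂ ^ r) N]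
    congr 2
    zify at hm
    linarith
  rw [Finset.sum_congr rfl hR, Finset.sum_fiberwise_of_maps_to (by
    intro β hβ
    rw [Set.Finite.mem_toFinset] at hβ
    exact Finset.mem_powerset.2 (cover_sub r n hr hn β hβ))]
  unfold zF
  rw [finsum_mem_eq_finite_toFinset_sum _ (Ftilde_finite r n hr hn)]
  simp only [map_mul, map_zpow₀, map_sum, hF1, hF2]
  rw [Finset.mul_sum, Finset.mul_sum]
  apply Finset.sum_congr rfl
  intro β _
  have hc := c_rec r n (by omega)
  set a := c r (n - 1)
  set b := c r (n - 2)
  set Y := 1 + x₂ ^ r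
  have h1 : x₂ ^ ((r : ℤ) * (B1 β : ℤ)) = (x₂ ^ r) ^ (B1 β) := by
    rw [zpow_mul, zpow_natCast, zpow_natCast]
  rw [h1]
  have h2 : (Y / x₁) ^ (-b) * (Y / x₁) ^ ((r : ℤ) * (a - (B2 r n β : ℤ))) =
      x₁ ^ (-(c r n)) * x₁ ^ ((r : ℤ) * (B2 r n β : ℤ)) *
        Y ^ (c r n - (r : ℤ) * (B2 r n β : ℤ)) := by
    rw [← zpow_add₀ (div_ne_zero hY hx1), ← zpow_add₀ hx1, div_zpow, div_eq_mul_inv, ← zpow_neg,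
      mul_comm, hc]
    congr 2 <;> ring
  calc x₂ ^ (-a) * (Y / x₁) ^ (-b) *
        ((x₂ ^ r) ^ (B1 β) * (Y / x₁) ^ ((r : ℤ) * (a - (B2 r n β : ℤ))))
      = x₂ ^ (-a) * (x₂ ^ r) ^ (B1 β) *
        ((Y / x₁) ^ (-b) * (Y / x₁) ^ ((r : ℤ) * (a - (B2 r n β : ℤ)))) := by ring
    _ = _ := by rw [h2]; ring

end CF
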